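/- arXiv:1401.2575 — 3 statements merged into one kernel-verified Lean document; each statement's English description precedes it below -/
import Mathlib

section
/- Let l, n ≥ 1 and let Δ(l,2,2n) be the triangle group with canonical generators P, Q. There is a group homomorphism ψ : Δ(l,2,2n) → ℤ/2ℤ with ψ(P) = 0 and ψ(Q) = 1. The kernel of ψ has index 2 in Δ(l,2,2n) and equals the subgroup generated by P and Q·P·Q⁻¹, and there is a surjective group homomorphism from Δ(l,l,n) onto this kernel sending the canonical generators X ↦ P and Y ↦ Q·P·Q⁻¹. -/
/-- The triangle group `Δ(l,m,n) = ⟨X, Y ∣ X^l = Y^m = (XY)^n = 1⟩`,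
with the canonical generators the images of `0, 1 : Fin 2`. -/
def triangleRels (l m n : ℕ) : Set (FreeGroup (Fin 2)) :=
  {FreeGroup.of 0 ^ l, FreeGroup.of 1 ^ m, (FreeGroup.of 0 * FreeGroup.of 1) ^ n}

abbrev TriangleGroup (l m n : ℕ) : Type := PresentedGroup (triangleRels l m n)

namespace TriangleGroup

variable {l m n : ℕ}

theorem of_zero_pow : (PresentedGroup.of 0 : TriangleGroup l m n) ^ l = 1 :=
  PresentedGroup.one_of_mem (rels := triangleRels l m n) (x := FreeGroup.of 0 ^ l)
    (by simp [triangleRels])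

theorem of_one_pow : (PresentedGroup.of 1 : TriangleGroup l m n) ^ m = 1 :=
  PresentedGroup.one_of_mem (rels := triangleRels l m n) (x := FreeGroup.of 1 ^ m)
    (by simp [triangleRels])

theorem of_mul_of_pow :
    (PresentedGroup.of 0 * PresentedGroup.of 1 : TriangleGroup l m n) ^ n = 1 :=
  PresentedGroup.one_of_mem (rels := triangleRels l m n)
    (x := (FreeGroup.of 0 * FreeGroup.of 1) ^ n) (by simp [triangleRels])

theorem closure_of :
    Subgroup.closure {PresentedGroup.of 0, (PresentedGroup.of 1 : TriangleGroup l m n)} = ⊤ := by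
  rw [← PresentedGroup.closure_range_of, ← Set.image_univ, ← Finset.coe_univ, Fin.univ_succ]
  simp [Set.image_pair]

theorem exists_hom {G : Type*} [Group G] {x y : G} (hx : x ^ l = 1) (hy : y ^ m = 1)
    (hxy : (x * y) ^ n = 1) :
    ∃ f : TriangleGroup l m n →* G, f (PresentedGroup.of 0) = x ∧ f (PresentedGroup.of 1) = y := by
  have h : ∀ r ∈ triangleRels l m n, FreeGroup.lift ![x, y] r = 1 := by
    rintro r (rfl | rfl | rfl) <;> simpa
  exact ⟨PresentedGroup.toGroup h, by simp, by simp⟩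

theorem range_eq_closure {G : Type*} [Group G] (f : TriangleGroup l m n →* G) :
    f.range = Subgroup.closure {f (PresentedGroup.of 0), f (PresentedGroup.of 1)} := by
  rw [MonoidHom.range_eq_map, ← closure_of, MonoidHom.map_closure, Set.image_pair]

end TriangleGroup

theorem mem_closure_conj_or_mul_mem {G : Type*} [Group G] {p q : G} (hq : q ^ 2 = 1)
    (h : Subgroup.closure {p, q} = ⊤) (g : G) :
    g ∈ Subgroup.closure {p, q * p * q⁻¹} ∨ g * q ∈ Subgroup.closure {p, q * p * q⁻¹} := by
  have hqq : q * q = 1 := by rwa [← pow_two]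
  have hinv : q⁻¹ = q := inv_eq_of_mul_eq_one_left hqq
  have hp : p ∈ Subgroup.closure {p, q * p * q⁻¹} := Subgroup.subset_closure (by simp)
  have hc : q * p * q⁻¹ ∈ Subgroup.closure {p, q * p * q⁻¹} := Subgroup.subset_closure (by simp)
  have hg : g ∈ Subgroup.closure {p, q} := h ▸ Subgroup.mem_top g
  have mul_q (x : G) (hx : x ∈ Subgroup.closure {p, q * p * q⁻¹} ∨
      x * q ∈ Subgroup.closure {p, q * p * q⁻¹}) :
      x * q ∈ Subgroup.closure {p, q * p * q⁻¹} ∨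
        x * q * q ∈ Subgroup.closure {p, q * p * q⁻¹} := by
    rwa [mul_assoc x q q, hqq, mul_one, or_comm]
  induction hg using Subgroup.closure_induction_right with
  | one => exact .inl (one_mem _)
  | mul_right x _ y hy ih =>
    rcases hy with rfl | rfl
    · refine ih.imp (fun hx => mul_mem hx hp) fun hx => ?_
      convert mul_mem hx hc using 1
      rw [hinv, mul_assoc q, ← mul_assoc (x * q), mul_assoc x q q, hqq, mul_one, mul_assoc]
    · exact mul_q x ih
  | mul_inv_cancel x _ y hy ih =>
    rcases hy with rfl | rfl
    · refine ih.imp (fun hx => mul_mem hx (inv_mem hp)) fun hx => ?_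
      convert mul_mem hx (inv_mem hc) using 1
      simp only [mul_inv_rev, hinv]
      rw [← mul_assoc (x * q), mul_assoc x q q, hqq, mul_one, mul_assoc]
    · rw [congrArg (x * ·) hinv]
      exact mul_q x ih

theorem ker_eq_closure_conj {G H : Type*} [Group G] [Group H] {p q : G} (hq : q ^ 2 = 1)
    (h : Subgroup.closure {p, q} = ⊤) (ψ : G →* H) (hψp : ψ p = 1) (hψq : ψ q ≠ 1) :
    ψ.ker = Subgroup.closure {p, q * p * q⁻¹} := by
  have hle : Subgroup.closure {p, q * p * q⁻¹} ≤ ψ.ker := by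
    rw [Subgroup.closure_le]
    rintro _ (rfl | rfl) <;> simp [MonoidHom.mem_ker, hψp]
  refine le_antisymm (fun g hg => ?_) hle
  refine (mem_closure_conj_or_mul_mem hq h g).resolve_right fun hgq => hψq ?_
  have := hle hgq
  rwa [MonoidHom.mem_ker, map_mul, MonoidHom.mem_ker.mp hg, one_mul] at this

/-- There is a homomorphism `ψ : Δ(l,2,2n) → ℤ/2ℤ` with `ψ P = 0`, `ψ Q = 1`
(`P, Q` the canonical generators); its kernel has index `2`, equals the subgroup
generated by `P` and `QPQ⁻¹`, and is a surjective image of `Δ(l,l,n)` via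
`X ↦ P`, `Y ↦ QPQ⁻¹`. -/
theorem stmt_12 (l n : ℕ) (hl : 1 ≤ l) (hn : 1 ≤ n) :
    ∃ ψ : TriangleGroup l 2 (2 * n) →* Multiplicative (ZMod 2),
      ψ (PresentedGroup.of 0) = Multiplicative.ofAdd (0 : ZMod 2) ∧
      ψ (PresentedGroup.of 1) = Multiplicative.ofAdd (1 : ZMod 2) ∧
      ψ.ker.index = 2 ∧
      ψ.ker = Subgroup.closure
        {PresentedGroup.of 0,
         PresentedGroup.of 1 * PresentedGroup.of 0 * (PresentedGroup.of 1)⁻¹} ∧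
      ∃ f : TriangleGroup l l n →* TriangleGroup l 2 (2 * n),
        f (PresentedGroup.of 0) = PresentedGroup.of 0 ∧
        f (PresentedGroup.of 1) =
          PresentedGroup.of 1 * PresentedGroup.of 0 * (PresentedGroup.of 1)⁻¹ ∧
        f.range = ψ.ker := by
  have hq : (PresentedGroup.of 1 : TriangleGroup l 2 (2 * n)) ^ 2 = 1 := TriangleGroup.of_one_pow
  obtain ⟨ψ, hψp, hψq⟩ := TriangleGroup.exists_hom (l := l) (m := 2) (n := 2 * n)
    (x := (1 : Multiplicative (ZMod 2))) (y := Multiplicative.ofAdd 1) (one_pow l) rfl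
    (by rw [one_mul, pow_mul]; exact one_pow n)
  obtain ⟨f, hfx, hfy⟩ := TriangleGroup.exists_hom (l := l) (m := l) (n := n)
    (x := (PresentedGroup.of 0 : TriangleGroup l 2 (2 * n)))
    (y := PresentedGroup.of 1 * PresentedGroup.of 0 * (PresentedGroup.of 1)⁻¹)
    TriangleGroup.of_zero_pow
    (by rw [conj_pow, TriangleGroup.of_zero_pow, mul_one, mul_inv_cancel])
    (by
      rw [inv_eq_of_mul_eq_one_left ((pow_two _).symm.trans hq), mul_assoc, ← mul_assoc,
        ← pow_two, ← pow_mul, TriangleGroup.of_mul_of_pow])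
  have hker := ker_eq_closure_conj hq TriangleGroup.closure_of ψ hψp (by rw [hψq]; decide)
  refine ⟨ψ, hψp, hψq, ?_, hker, f, hfx, hfy, ?_⟩
  · have hsurj : Function.Surjective ψ := fun z => by
      have hz : z = 1 ∨ z = Multiplicative.ofAdd 1 := by revert z; decide
      rcases hz with rfl | rfl
      exacts [⟨1, map_one ψ⟩, ⟨_, hψq⟩]
    rw [Subgroup.index_ker, MonoidHom.range_eq_top.mpr hsurj, Subgroup.card_top,
      Nat.card_eq_fintype_card]
    rfl
  · rw [TriangleGroup.range_eq_closure, hfx, hfy, hker]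
end

section
/- Let F be a finite field of characteristic 2 with more than 2 elements. Then the group AGL₁(F) of affine permutations of F (the maps x ↦ a·x + b with a ∈ Fˣ, b ∈ F, under composition) has trivial center and is generated by its elements of odd order. -/
namespace AffineEquiv

variable {k : Type*} [Field k]

theorem apply_eq_linear_one_mul_add (g : k ≃ᵃ[k] k) (x : k) :
    g x = g.linear 1 * x + g 0 := by
  have h := g.map_vadd 0 x
  have hx : g.linear x = x * g.linear 1 := by
    simpa using g.linear.map_smul x 1
  simp only [vadd_eq_add, add_zero] at h
  rw [h, hx, mul_comm]

/-- An affine permutation of a field whose linear part is not the identity is a homothety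
about its fixed point. -/
theorem exists_eq_homothetyUnitsMulHom (g : k ≃ᵃ[k] k) (hg : g.linear 1 ≠ 1) :
    ∃ (p : k) (t : kˣ), g = homothetyUnitsMulHom p t := by
  have h0 : g.linear 1 ≠ 0 := by simp
  have h1 : 1 - g.linear 1 ≠ 0 := sub_ne_zero.mpr hg.symm
  refine ⟨g 0 / (1 - g.linear 1), Units.mk0 _ h0, ext fun x => ?_⟩
  rw [apply_eq_linear_one_mul_add g x, coe_homothetyUnitsMulHom_apply, AffineMap.homothety_apply]
  simp only [Units.val_mk0, vsub_eq_sub, smul_eq_mul, vadd_eq_add]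
  field_simp
  ring

theorem center_eq_bot_of_unit_ne_one {t : kˣ} (ht : t ≠ 1) :
    Subgroup.center (k ≃ᵃ[k] k) = ⊥ := by
  refine (Subgroup.eq_bot_iff_forall _).mpr fun g hg => ext fun p => ?_
  have h := congrArg (fun f : k ≃ᵃ[k] k => f p)
    (Subgroup.mem_center_iff.mp hg (homothetyUnitsMulHom p t))
  simp only [coe_mul, Function.comp_apply, coe_homothetyUnitsMulHom_apply,
    AffineMap.homothety_apply, vsub_eq_sub, smul_eq_mul, vadd_eq_add, sub_self, mul_zero,
    zero_add] at h
  have h' : ((t : k) - 1) * (g p - p) = 0 := by linear_combination h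
  have ht' : (t : k) - 1 ≠ 0 := sub_ne_zero.mpr (by simpa using ht)
  simpa [sub_eq_zero] using (mul_eq_zero.mp h').resolve_left ht'

theorem closure_eq_top_of_homothety_mem {t : kˣ} (ht : t ≠ 1) {S : Set (k ≃ᵃ[k] k)}
    (hS : ∀ (p : k) (u : kˣ), homothetyUnitsMulHom p u ∈ S) :
    Subgroup.closure S = ⊤ := by
  have key (g : k ≃ᵃ[k] k) (hg : g.linear 1 ≠ 1) : g ∈ Subgroup.closure S := by
    obtain ⟨p, u, rfl⟩ := exists_eq_homothetyUnitsMulHom g hg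
    exact Subgroup.subset_closure (hS p u)
  refine (Subgroup.eq_top_iff' _).mpr fun g => ?_
  by_cases hg : g.linear 1 = 1
  · refine (Subgroup.mul_mem_cancel_left _
      (Subgroup.subset_closure (hS 0 t))).mp (key _ ?_)
    have h := apply_eq_linear_one_mul_add (homothetyUnitsMulHom 0 t * g) 1
    have h1 := apply_eq_linear_one_mul_add g 1
    simp only [coe_mul, Function.comp_apply, coe_homothetyUnitsMulHom_apply,
      AffineMap.homothety_apply, vsub_eq_sub, smul_eq_mul, vadd_eq_add, sub_zero, add_zero,
      mul_one] at h h1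
    rw [h1, hg] at h
    intro h2
    exact ht (Units.ext (by simp only [Units.val_one]; linear_combination h + h2))
  · exact key g hg

end AffineEquiv

theorem FiniteField.odd_orderOf_units {F : Type*} [Field F] [Fintype F] [CharP F 2] (t : Fˣ) :
    Odd (orderOf t) := by
  have h : Even (Fintype.card F) :=
    Nat.even_iff.mpr (FiniteField.even_card_of_char_two (ringChar.eq F 2))
  have hodd : Odd (Fintype.card F - 1) := Nat.Even.sub_odd Fintype.card_pos h odd_one
  exact hodd.of_dvd_nat (orderOf_dvd_of_pow_eq_one (Units.ext <| by
    simpa using FiniteField.pow_card_sub_one_eq_one (t : F) t.ne_zero))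

/-- For a finite field `F` of characteristic `2` with more than `2` elements, the group
`AGL₁(F)` of affine permutations `x ↦ a·x + b` of `F` (the affine self-equivalences of
`F` as an affine space over itself) has trivial center and is generated by its elements
of odd order. -/
theorem stmt_16 (F : Type*) [Field F] [Fintype F] [CharP F 2]
    (hcard : 2 < Fintype.card F) :
    Subgroup.center (F ≃ᵃ[F] F) = ⊥ ∧
    Subgroup.closure {g : F ≃ᵃ[F] F | Odd (orderOf g)} = ⊤ := by
  classical
  obtain ⟨t, ht⟩ : ∃ t : Fˣ, t ≠ 1 := by
    have : 1 < Fintype.card Fˣ := by rw [Fintype.card_units]; omega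
    exact Fintype.exists_ne_of_one_lt_card this 1
  exact ⟨AffineEquiv.center_eq_bot_of_unit_ne_one ht,
    AffineEquiv.closure_eq_top_of_homothety_mem ht fun p u =>
      (FiniteField.odd_orderOf_units u).of_dvd_nat (orderOf_map_dvd _ u)⟩
end

section
/- For n ≥ 1, the triangle group Δ(2n,2,2n), with canonical generators P, Q satisfying P^{2n} = Q² = (PQ)^{2n} = 1, has exactly one normal subgroup K such that the quotient Δ(2n,2,2n)/K is isomorphic to the Klein four-group C₂ × C₂, namely the kernel of the group homomorphism Δ(2n,2,2n) → C₂ × C₂ sending P ↦ (1,0) and Q ↦ (0,1). -/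
/-- The Klein four-group `C₂ × C₂`. -/
abbrev KleinFour : Type := Multiplicative (ZMod 2) × Multiplicative (ZMod 2)

/-- The endomorphism of the Klein four-group sending `(1,0) ↦ a` and `(0,1) ↦ b`. -/
def KleinFour.endOfImages (a b : KleinFour) : KleinFour →* KleinFour :=
  MonoidHom.mk' (fun x => a ^ x.1.toAdd.val * b ^ x.2.toAdd.val) (by
    revert a b; decide +kernel)

/-- Any map of generators into the Klein four-group extends to `Δ(2n,2,2n)`. -/
theorem triangleRels_lift_kleinFour (n : ℕ) (f : Fin 2 → KleinFour) :
    ∀ r ∈ triangleRels (2 * n) 2 (2 * n), FreeGroup.lift f r = 1 := by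
  have hsq : ∀ x : KleinFour, x ^ 2 = 1 := by decide
  rintro r (rfl | rfl | rfl) <;> simp [pow_mul, hsq]

/-- Every surjection onto the Klein four-group which factors through a homomorphism from the
Klein four-group to itself has the same kernel as that factor. -/
theorem KleinFour.ker_comp_eq {G : Type*} [Group G] (χ : KleinFour →* KleinFour)
    (ψ : G →* KleinFour) (h : Function.Surjective (χ.comp ψ)) : (χ.comp ψ).ker = ψ.ker := by
  have hχ : Function.Injective χ :=
    Finite.injective_iff_surjective.2 (Function.Surjective.of_comp (g := ψ) h)
  ext x
  simp [MonoidHom.mem_ker, map_eq_one_iff χ hχ]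

/-- `Δ(2n,2,2n)` (canonical generators `P, Q`) has exactly one normal subgroup `K` with
quotient isomorphic to `C₂ × C₂` (a quotient isomorphic to `C₂ × C₂` being expressed by
a surjective homomorphism onto `C₂ × C₂` with kernel `K`), namely the kernel of the
homomorphism `Δ(2n,2,2n) → C₂ × C₂` sending `P ↦ (1,0)`, `Q ↦ (0,1)`. -/
theorem stmt_18 (n : ℕ) (hn : 1 ≤ n) :
    ∃ ψ : TriangleGroup (2 * n) 2 (2 * n) →* KleinFour,
      ψ (PresentedGroup.of 0) =
        (Multiplicative.ofAdd (1 : ZMod 2), Multiplicative.ofAdd (0 : ZMod 2)) ∧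
      ψ (PresentedGroup.of 1) =
        (Multiplicative.ofAdd (0 : ZMod 2), Multiplicative.ofAdd (1 : ZMod 2)) ∧
      ∀ K : Subgroup (TriangleGroup (2 * n) 2 (2 * n)),
        (K.Normal ∧ ∃ φ : TriangleGroup (2 * n) 2 (2 * n) →* KleinFour,
            Function.Surjective φ ∧ φ.ker = K)
        ↔ K = ψ.ker := by
  let f : Fin 2 → KleinFour :=
    ![(Multiplicative.ofAdd 1, Multiplicative.ofAdd 0),
      (Multiplicative.ofAdd 0, Multiplicative.ofAdd 1)]
  let ψ : TriangleGroup (2 * n) 2 (2 * n) →* KleinFour :=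
    PresentedGroup.toGroup (triangleRels_lift_kleinFour n f)
  have hP : ψ (PresentedGroup.of 0) = f 0 := PresentedGroup.toGroup.of _
  have hQ : ψ (PresentedGroup.of 1) = f 1 := PresentedGroup.toGroup.of _
  refine ⟨ψ, hP, hQ, fun K => ⟨?_, ?_⟩⟩
  · rintro ⟨-, φ, hφ, rfl⟩
    have hfac : φ = (KleinFour.endOfImages (φ (PresentedGroup.of 0))
        (φ (PresentedGroup.of 1))).comp ψ := by
      refine PresentedGroup.ext fun i => ?_
      fin_cases i
      · simp [hP, f, KleinFour.endOfImages, ZMod.val_one]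
      · simp [hQ, f, KleinFour.endOfImages, ZMod.val_one]
    rw [hfac] at hφ ⊢
    exact KleinFour.ker_comp_eq _ _ hφ
  · rintro rfl
    refine ⟨inferInstance, ψ, ?_, rfl⟩
    have hgen : ∀ y : KleinFour, y = f 0 ^ y.1.toAdd.val * f 1 ^ y.2.toAdd.val := by decide
    intro y
    refine ⟨PresentedGroup.of 0 ^ y.1.toAdd.val * PresentedGroup.of 1 ^ y.2.toAdd.val, ?_⟩
    rw [map_mul, map_pow, map_pow, hP, hQ, ← hgen y]
end
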